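/- arXiv:1705.08067 — 2 statements merged into one kernel-verified Lean document; each statement's English description precedes it below -/
import Mathlib

section
/- Let w ≥ 1 and z_1,…,z_w be complex numbers, let n ≥ 1, 0 ≤ m ≤ n, d = n − m, let ρ, σ be strictly increasing m-tuples with entries in {1,…,n}, and let ξ = (ξ_1 < … < ξ_d), η = (η_1 < … < η_d) be the complements of ρ and σ in {1,…,n}. Let b(t) = Σ_{k=0}^w e_k t^{−k}, so (T_n(b))_{j,k} = e_{k−j}. Then det(T_n(b)_{ρ,σ}) = s_{rev(ξ − id_d)/rev(η − id_d)}(z_1,…,z_w), i.e. the skew Schur polynomial with outer partition λ = (ξ_d − d, ξ_{d−1} − (d−1), …, ξ_1 − 1) and inner partition μ = (η_d − d, …, η_1 − 1). -/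
open scoped BigOperators

/-- The `r`-th elementary symmetric polynomial in `w` variables, evaluated at `z`,
extended by `0` to negative integer indices (and automatically `0` for `r > w`). -/
noncomputable def eInt (w : ℕ) (z : Fin w → ℂ) (r : ℤ) : ℂ :=
  if 0 ≤ r then
    ∑ s ∈ Finset.powersetCard r.toNat (Finset.univ : Finset (Fin w)), ∏ i ∈ s, z i
  else 0

/-- The `r`-th complete homogeneous symmetric polynomial in `w` variables, evaluated at `z`,
extended by `0` to negative integer indices. -/
noncomputable def hInt (w : ℕ) (z : Fin w → ℂ) (r : ℤ) : ℂ :=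
  if 0 ≤ r then ∑ m : Sym (Fin w) r.toNat, (m.1.map z).prod else 0

/-- Skew Schur polynomial via the Jacobi–Trudi determinant
`s_{λ/μ} = det [h_{λ_j - μ_k - j + k}]_{j,k=1}^{ℓ}`,
where the parts are given as `1`-based integer sequences `lam`, `mu`. -/
noncomputable def skewSchur (w : ℕ) (z : Fin w → ℂ) (ℓ : ℕ) (lam mu : ℕ → ℤ) : ℂ :=
  Matrix.det (Matrix.of fun j k : Fin ℓ =>
    hInt w z (lam (j.1 + 1) - mu (k.1 + 1) - ((j.1 : ℤ) + 1) + ((k.1 : ℤ) + 1)))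

/-- Schur polynomial `s_λ`. -/
noncomputable def schur (w : ℕ) (z : Fin w → ℂ) (ℓ : ℕ) (lam : ℕ → ℤ) : ℂ :=
  skewSchur w z ℓ lam (fun _ => 0)

/-- Coefficients of the Laurent polynomial `a(t) = a_p t^(p-w) ∏_{j=1}^w (t - z_j)`,
namely `a_k = (-1)^(p-k) * a_p * e_{p-k}(z_1,…,z_w)`. -/
noncomputable def aCoeff (w p : ℕ) (ap : ℂ) (z : Fin w → ℂ) (k : ℤ) : ℂ :=
  (-1 : ℂ) ^ ((p : ℤ) - k) * ap * eInt w z ((p : ℤ) - k)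

/-- The `n × n` Toeplitz matrix `[a_{j-k}]_{j,k=1}^n` with coefficient sequence `a`. -/
noncomputable def toeplitz (n : ℕ) (a : ℤ → ℂ) : Matrix (Fin n) (Fin n) ℂ :=
  Matrix.of fun j k => a ((j.1 : ℤ) - (k.1 : ℤ))
open Finset in
/-- The generating function of the complete homogeneous symmetric polynomials. -/
theorem coeff_prod_geometric {ι R : Type*} [Fintype ι] [DecidableEq ι] [CommRing R]
    (z : ι → R) (r : ℕ) :
    PowerSeries.coeff r (∏ i, PowerSeries.mk fun k => z i ^ k)
      = ∑ m : Sym ι r, (m.1.map z).prod := by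
  rw [PowerSeries.coeff_prod]
  simp only [PowerSeries.coeff_mk]
  symm
  refine Finset.sum_bij (fun s _ => (Sym.equivNatSum ι r s).1) ?_ ?_ ?_ ?_
  · intro s _
    have h := (Sym.equivNatSum ι r s).2
    rw [Finsupp.sum_fintype _ _ (by simp)] at h
    exact mem_finsuppAntidiag.2 ⟨h, subset_univ _⟩
  · intro s _ t _ h
    exact (Sym.equivNatSum ι r).injective (Subtype.ext h)
  · intro l hl
    have h : l.sum (fun _ => id) = r := by
      rw [Finsupp.sum_fintype _ _ (by simp)]
      simpa [mem_finsuppAntidiag] using hl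
    exact ⟨(Sym.equivNatSum ι r).symm ⟨l, h⟩, mem_univ _, by simp⟩
  · intro s _
    rw [Finset.prod_multiset_map_count]
    refine (Finset.prod_subset (subset_univ _) ?_).trans ?_
    · intro i _ hi
      rw [Multiset.count_eq_zero_of_notMem (by simpa using hi), pow_zero]
    · exact Finset.prod_congr rfl fun i _ => by rw [Sym.coe_equivNatSum_apply_apply]; rfl

open Finset in
/-- The generating function of the elementary symmetric polynomials. -/
theorem coeff_prod_one_add_C_mul_X {ι R : Type*} [Fintype ι] [CommRing R]
    (z : ι → R) (r : ℕ) :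
    PowerSeries.coeff r (∏ i, (1 + PowerSeries.C (z i) * PowerSeries.X))
      = ∑ s ∈ powersetCard r univ, ∏ i ∈ s, z i := by
  rw [prod_one_add, map_sum, powersetCard_eq_filter, sum_filter]
  refine sum_congr rfl fun s _ => ?_
  rw [prod_mul_distrib, prod_const, ← map_prod, PowerSeries.coeff_C_mul, PowerSeries.coeff_X_pow]
  simp [eq_comm]

theorem prod_one_add_mul_prod_geometric {ι R : Type*} [Fintype ι] [CommRing R] (z : ι → R) :
    (∏ i, (1 + PowerSeries.C (z i) * PowerSeries.X)) *
      (∏ i, PowerSeries.mk fun k => (-z i) ^ k) = 1 := by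
  rw [← Finset.prod_mul_distrib]
  refine Finset.prod_eq_one fun i _ => ?_
  ext k
  cases k with
  | zero => simp [add_mul, mul_assoc]
  | succ k =>
    rw [add_mul, one_mul, mul_assoc, map_add, PowerSeries.coeff_C_mul, PowerSeries.coeff_succ_X_mul,
      PowerSeries.coeff_mk, PowerSeries.coeff_mk, PowerSeries.coeff_one]
    simp [pow_succ]
    ring

/-- The upper triangular Toeplitz matrix whose diagonals are the coefficients of a power series. -/
noncomputable def upperToeplitz {R : Type*} [CommRing R] (n : ℕ) (f : PowerSeries R) :
    Matrix (Fin n) (Fin n) R :=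
  Matrix.of fun j k => if j ≤ k then PowerSeries.coeff (k.1 - j.1) f else 0

theorem upperToeplitz_one {R : Type*} [CommRing R] (n : ℕ) :
    upperToeplitz n (1 : PowerSeries R) = 1 := by
  ext j k
  simp only [upperToeplitz, Matrix.of_apply, PowerSeries.coeff_one, Matrix.one_apply, Fin.le_def,
    Fin.ext_iff]
  grind

theorem upperToeplitz_mul {R : Type*} [CommRing R] (n : ℕ) (f g : PowerSeries R) :
    upperToeplitz n f * upperToeplitz n g = upperToeplitz n (f * g) := by
  ext j l
  simp only [Matrix.mul_apply, upperToeplitz, Matrix.of_apply, Fin.le_def]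
  rw [Fin.sum_univ_eq_sum_range (fun k => (if j.1 ≤ k then PowerSeries.coeff (k - j.1) f else 0) *
    (if k ≤ l.1 then PowerSeries.coeff (l.1 - k) g else 0)) n]
  have hsub : Finset.Ico j.1 (l.1 + 1) ⊆ Finset.range n := by
    intro k hk
    rw [Finset.mem_Ico] at hk
    rw [Finset.mem_range]
    omega
  rw [← Finset.sum_subset hsub, Finset.sum_Ico_eq_sum_range]
  · split_ifs with h
    · rw [PowerSeries.coeff_mul, Finset.Nat.sum_antidiagonal_eq_sum_range_succ_mk,
        show l.1 + 1 - j.1 = (l.1 - j.1).succ by omega]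
      refine Finset.sum_congr rfl fun k hk => ?_
      rw [Finset.mem_range] at hk
      rw [if_pos (by omega), if_pos (by omega), show j.1 + k - j.1 = k by omega,
        show l.1 - (j.1 + k) = l.1 - j.1 - k by omega]
    · rw [show l.1 + 1 - j.1 = 0 by omega, Finset.sum_range_zero]
  · intro k _ hk
    rw [Finset.mem_Ico] at hk
    split_ifs <;> first | omega | simp

theorem det_upperToeplitz {R : Type*} [CommRing R] (n : ℕ) (f : PowerSeries R) :
    (upperToeplitz n f).det = PowerSeries.constantCoeff f ^ n := by
  rw [Matrix.det_of_isUpperTriangular]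
  · simp [upperToeplitz]
  · intro j k hjk
    exact if_neg (not_le.mpr hjk)

/-- A minor of a block matrix in terms of the complementary minor of its inverse. -/
theorem Matrix.det_toBlocks₁₁_of_mul_eq_one {k l R : Type*} [Fintype k] [Fintype l]
    [DecidableEq k] [DecidableEq l] [CommRing R] {M N : Matrix (k ⊕ l) (k ⊕ l) R}
    (h : M * N = 1) : M.toBlocks₁₁.det = M.det * N.toBlocks₂₂.det := by
  have key : M * Matrix.fromBlocks 1 N.toBlocks₁₂ 0 N.toBlocks₂₂
      = Matrix.fromBlocks M.toBlocks₁₁ 0 M.toBlocks₂₁ 1 := by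
    rw [← M.fromBlocks_toBlocks, ← N.fromBlocks_toBlocks, Matrix.fromBlocks_multiply,
      ← Matrix.fromBlocks_one, Matrix.fromBlocks_inj] at h
    conv_lhs => rw [← M.fromBlocks_toBlocks]
    rw [Matrix.fromBlocks_multiply]
    simp only [Matrix.mul_one, Matrix.mul_zero, add_zero, h.2.1, h.2.2.2]
  have := congrArg Matrix.det key
  rw [Matrix.det_mul, Matrix.det_fromBlocks_zero₂₁, Matrix.det_fromBlocks_zero₁₂] at this
  simpa using this.symm

/-- Jacobi's complementary minor formula for two permutations of the index set. -/
theorem Matrix.det_submatrix_perm_castAdd {m d : ℕ} {R : Type*} [CommRing R]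
    {A B : Matrix (Fin (m + d)) (Fin (m + d)) R} (hAB : A * B = 1)
    (P Q : Equiv.Perm (Fin (m + d))) :
    (A.submatrix (P ∘ Fin.castAdd d) (Q ∘ Fin.castAdd d)).det
      = ((Equiv.Perm.sign P : ℤ) : R) * ((Equiv.Perm.sign Q : ℤ) : R) * A.det *
        (B.submatrix (Q ∘ Fin.natAdd m) (P ∘ Fin.natAdd m)).det := by
  have hMN : (A.submatrix (P ∘ finSumFinEquiv) (Q ∘ finSumFinEquiv)) *
      (B.submatrix (Q ∘ finSumFinEquiv) (P ∘ finSumFinEquiv)) = 1 := by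
    have := Matrix.submatrix_mul_equiv A B (P ∘ finSumFinEquiv) (finSumFinEquiv.trans Q)
      (P ∘ finSumFinEquiv)
    rw [Equiv.coe_trans] at this
    rw [this, hAB]
    exact Matrix.submatrix_one_equiv (finSumFinEquiv.trans P)
  have hdet : (A.submatrix (P ∘ finSumFinEquiv) (Q ∘ finSumFinEquiv)).det
      = ((Equiv.Perm.sign P : ℤ) : R) * ((Equiv.Perm.sign Q : ℤ) : R) * A.det := by
    have h := Matrix.det_submatrix_equiv_self finSumFinEquiv (A.submatrix P Q)
    rw [Matrix.submatrix_submatrix] at h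
    rw [h, show A.submatrix P Q = (A.submatrix P id).submatrix id Q by simp,
      Matrix.det_permute', Matrix.det_permute]
    ring
  have h := Matrix.det_toBlocks₁₁_of_mul_eq_one hMN
  rw [hdet] at h
  convert h using 2 <;> · congr 1

open Finset in
/-- The sign of a permutation of `Fin (m + d)` that is increasing on the first `m` and on the last
`d` indices. -/
theorem Equiv.Perm.sign_of_strictMono_castAdd_natAdd {m d : ℕ} (P : Equiv.Perm (Fin (m + d)))
    (h₁ : StrictMono (P ∘ Fin.castAdd d)) (h₂ : StrictMono (P ∘ Fin.natAdd m)) :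
    Equiv.Perm.sign P = ∏ i : Fin m, (-1) ^ ((P (Fin.castAdd d i)).1 + i.1) := by
  rw [Equiv.Perm.sign_eq_prod_prod_Ioi, Fin.prod_univ_add]
  have hinner : ∀ i : Fin (m + d), (∏ j > i, if P i < P j then (1 : ℤˣ) else -1)
      = (-1) ^ #{j | i < j ∧ P j < P i} := by
    intro i
    rw [prod_ite, prod_const_one, one_mul, prod_const]
    congr 2
    ext j
    simp only [mem_filter, mem_Ioi, mem_univ, true_and, not_lt]
    refine and_congr_right fun hij => ⟨fun h => lt_of_le_of_ne h ?_, le_of_lt⟩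
    exact fun h => hij.ne' (P.injective h)
  simp only [hinner]
  rw [prod_eq_one (s := (univ : Finset (Fin d))), mul_one]
  · refine prod_congr rfl fun i _ => ?_
    have hcard : (P (Fin.castAdd d i)).1
        = i.1 + #{j | Fin.castAdd d i < j ∧ P j < P (Fin.castAdd d i)} := by
      have h1 : #{j | P j < P (Fin.castAdd d i)} = (P (Fin.castAdd d i)).1 := by
        rw [← Fin.card_Iio, ← card_map P.toEmbedding]
        congr 1
        ext j
        simp only [mem_map_equiv, mem_filter, mem_univ, true_and, mem_Iio, Equiv.apply_symm_apply]
      have h2 : ({j | P j < P (Fin.castAdd d i)} : Finset (Fin (m + d)))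
          = Iio (Fin.castAdd d i) ∪
            univ.filter fun j => Fin.castAdd d i < j ∧ P j < P (Fin.castAdd d i) := by
        ext j
        simp only [mem_filter, mem_univ, true_and, mem_union, mem_Iio]
        constructor
        · intro hj
          rcases lt_trichotomy j (Fin.castAdd d i) with h | h | h
          · exact Or.inl h
          · exact absurd hj (by simp [h])
          · exact Or.inr ⟨h, hj⟩
        · rintro (h | h)
          · have hjm : j.1 < m := lt_trans h i.2
            exact @h₁ ⟨j.1, hjm⟩ i h
          · exact h.2
      rw [← h1, h2, card_union_of_disjoint, Fin.card_Iio]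
      · rfl
      · rw [disjoint_left]
        intro j hj hj'
        simp only [mem_filter, mem_univ, true_and, mem_Iio] at hj hj'
        exact lt_asymm hj hj'.1
    conv_rhs => rw [hcard]
    rw [show ∀ a b : ℕ, a + b + a = 2 * a + b by intros; ring, pow_add, pow_mul]
    simp
  · intro i _
    rw [filter_eq_empty_iff.mpr, card_empty, pow_zero]
    rintro j - ⟨hij, hP⟩
    have hmj : m ≤ j.1 := by
      have : m + i.1 < j.1 := hij
      omega
    have hj : j = Fin.natAdd m ⟨j.1 - m, by omega⟩ := by
      ext
      simp only [Fin.val_natAdd]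
      omega
    rw [hj] at hij hP
    exact lt_asymm hP (h₂ ((Fin.natAdd_lt_natAdd_iff m).1 hij))

/-- Two complementary strictly increasing tuples, one after the other, as a permutation. -/
theorem exists_perm_of_complementary {m d : ℕ} {ρ ξ : ℕ → ℕ}
    (hρ : StrictMonoOn ρ (Set.Icc 1 m)) (hξ : StrictMonoOn ξ (Set.Icc 1 d))
    (hρran : ρ '' Set.Icc 1 m ⊆ Set.Icc 1 (m + d))
    (hξran : ξ '' Set.Icc 1 d = Set.Icc 1 (m + d) \ ρ '' Set.Icc 1 m) :
    ∃ P : Equiv.Perm (Fin (m + d)),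
      (∀ i : Fin m, ρ (i.1 + 1) = (P (Fin.castAdd d i)).1 + 1) ∧
      (∀ i : Fin d, ξ (i.1 + 1) = (P (Fin.natAdd m i)).1 + 1) ∧
      StrictMono (P ∘ Fin.castAdd d) ∧ StrictMono (P ∘ Fin.natAdd m) := by
  have hI : ∀ {l : ℕ} (i : Fin l), i.1 + 1 ∈ Set.Icc 1 l := fun i => ⟨by omega, i.2⟩
  have hρm : ∀ i : Fin m, 1 ≤ ρ (i.1 + 1) ∧ ρ (i.1 + 1) ≤ m + d := fun i =>
    hρran ⟨_, hI i, rfl⟩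
  have hξm : ∀ i : Fin d, ξ (i.1 + 1) ∈ Set.Icc 1 (m + d) \ ρ '' Set.Icc 1 m := fun i =>
    hξran ▸ ⟨_, hI i, rfl⟩
  have hξm' : ∀ i : Fin d, 1 ≤ ξ (i.1 + 1) ∧ ξ (i.1 + 1) ≤ m + d := fun i => (hξm i).1
  have hne : ∀ (i : Fin m) (j : Fin d), ρ (i.1 + 1) ≠ ξ (j.1 + 1) := fun i j h =>
    (hξm j).2 ⟨_, hI i, h⟩
  have hρlt : ∀ i j : Fin m, i < j → ρ (i.1 + 1) < ρ (j.1 + 1) := fun i j h =>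
    hρ (hI i) (hI j) (Nat.succ_lt_succ h)
  have hξlt : ∀ i j : Fin d, i < j → ξ (i.1 + 1) < ξ (j.1 + 1) := fun i j h =>
    hξ (hI i) (hI j) (Nat.succ_lt_succ h)
  let f : Fin (m + d) → Fin (m + d) := Fin.addCases
    (fun i => ⟨ρ (i.1 + 1) - 1, by have := hρm i; omega⟩)
    (fun i => ⟨ξ (i.1 + 1) - 1, by have := hξm' i; omega⟩)
  have f₁ : ∀ i, (f (Fin.castAdd d i)).1 = ρ (i.1 + 1) - 1 := fun i => by simp [f]
  have f₂ : ∀ i, (f (Fin.natAdd m i)).1 = ξ (i.1 + 1) - 1 := fun i => by simp [f]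
  have hf : Function.Injective f := by
    intro a b hab
    have hab' := congrArg Fin.val hab
    induction a using Fin.addCases with
    | left i =>
      induction b using Fin.addCases with
      | left j =>
        rw [f₁, f₁] at hab'
        have := hρm i
        have := hρm j
        rcases lt_trichotomy i j with h | h | h
        · have := hρlt _ _ h
          omega
        · rw [h]
        · have := hρlt _ _ h
          omega
      | right j =>
        rw [f₁, f₂] at hab'
        have := hρm i
        have := hξm' j
        have := hne i j
        omega
    | right i =>
      induction b using Fin.addCases with
      | left j =>
        rw [f₁, f₂] at hab'
        have := hρm j
        have := hξm' i
        have := hne j i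
        omega
      | right j =>
        rw [f₂, f₂] at hab'
        have := hξm' i
        have := hξm' j
        rcases lt_trichotomy i j with h | h | h
        · have := hξlt _ _ h
          omega
        · rw [h]
        · have := hξlt _ _ h
          omega
  refine ⟨Equiv.ofBijective f (Finite.injective_iff_bijective.mp hf), fun i => ?_, fun i => ?_,
    fun i j h => ?_, fun i j h => ?_⟩
  · have := hρm i
    rw [Equiv.ofBijective_apply, f₁]
    omega
  · have := hξm' i
    rw [Equiv.ofBijective_apply, f₂]
    omega
  · have := hρm i
    have := hρlt i j h
    rw [Fin.lt_def, Function.comp_apply, Function.comp_apply, Equiv.ofBijective_apply,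
      Equiv.ofBijective_apply, f₁, f₁]
    omega
  · have := hξm' i
    have := hξlt i j h
    rw [Fin.lt_def, Function.comp_apply, Function.comp_apply, Equiv.ofBijective_apply,
      Equiv.ofBijective_apply, f₂, f₂]
    omega

theorem eInt_sub_eq_upperToeplitz (w : ℕ) (z : Fin w → ℂ) (n : ℕ) (j k : Fin n) :
    eInt w z ((k.1 : ℤ) - (j.1 : ℤ))
      = upperToeplitz n (∏ i, (1 + PowerSeries.C (z i) * PowerSeries.X)) j k := by
  simp only [upperToeplitz, Matrix.of_apply, coeff_prod_one_add_C_mul_X, eInt, Fin.le_def,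
    sub_nonneg, Nat.cast_le]
  rw [show ((k.1 : ℤ) - (j.1 : ℤ)).toNat = k.1 - j.1 by omega]

theorem neg_one_pow_mul_hInt_sub_eq_upperToeplitz (w : ℕ) (z : Fin w → ℂ) (n : ℕ) (j k : Fin n) :
    (-1) ^ j.1 * ((-1) ^ k.1 * hInt w z ((k.1 : ℤ) - (j.1 : ℤ)))
      = upperToeplitz n (∏ i, PowerSeries.mk fun r => (-z i) ^ r) j k := by
  simp only [upperToeplitz, Matrix.of_apply, coeff_prod_geometric, hInt, Fin.le_def,
    sub_nonneg, Nat.cast_le]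
  rw [show ((k.1 : ℤ) - (j.1 : ℤ)).toNat = k.1 - j.1 by omega]
  split_ifs with h
  · have hneg : ∀ s : Sym (Fin w) (k.1 - j.1), (s.1.map fun i => -z i).prod
        = (-1) ^ (k.1 - j.1) * (s.1.map z).prod := by
      intro s
      have hs : s.1.card = k.1 - j.1 := s.2
      simp_rw [neg_eq_neg_one_mul (z _)]
      rw [Multiset.prod_map_mul, Multiset.map_const', Multiset.prod_replicate, hs]
    simp_rw [hneg]
    rw [← Finset.mul_sum, ← mul_assoc, ← pow_add]
    congr 1
    obtain ⟨t, ht⟩ := Nat.exists_eq_add_of_le h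
    rw [ht, show j.1 + (j.1 + t) = 2 * j.1 + t by ring, pow_add, pow_mul]
    simp
  · simp

/-- Lemma 3, formula (eq:minor_triangular_xieta): for the upper triangular Toeplitz matrix
`(T_n(b))_{j,k} = e_{k-j}`,
`det(T_n(b)_{ρ,σ}) = s_{rev(ξ - id_d)/rev(η - id_d)}(z_1,…,z_w)`,
with outer partition `(ξ_d - d, …, ξ_1 - 1)` and inner partition `(η_d - d, …, η_1 - 1)`. -/
theorem triangular_toeplitz_minor_eq_skewSchur_complement
    (w : ℕ) (hw : 1 ≤ w) (z : Fin w → ℂ)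
    (n m d : ℕ) (hn : 1 ≤ n) (hmn : m ≤ n) (hd : d = n - m)
    (ρ σ ξ η : ℕ → ℕ)
    (hρmono : StrictMonoOn ρ (Set.Icc 1 m)) (hσmono : StrictMonoOn σ (Set.Icc 1 m))
    (hξmono : StrictMonoOn ξ (Set.Icc 1 d)) (hηmono : StrictMonoOn η (Set.Icc 1 d))
    (hρran : ρ '' Set.Icc 1 m ⊆ Set.Icc 1 n)
    (hσran : σ '' Set.Icc 1 m ⊆ Set.Icc 1 n)
    (hξran : ξ '' Set.Icc 1 d = Set.Icc 1 n \ ρ '' Set.Icc 1 m)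
    (hηran : η '' Set.Icc 1 d = Set.Icc 1 n \ σ '' Set.Icc 1 m) :
    Matrix.det (Matrix.of fun j k : Fin m =>
        eInt w z ((σ (k.1 + 1) : ℤ) - (ρ (j.1 + 1) : ℤ)))
      = skewSchur w z d
          (fun j => (ξ (d + 1 - j) : ℤ) - ((d + 1 - j : ℕ) : ℤ))
          (fun k => (η (d + 1 - k) : ℤ) - ((d + 1 - k : ℕ) : ℤ)) := by
  obtain ⟨d', rfl⟩ := Nat.exists_eq_add_of_le hmn
  obtain rfl : d = d' := by omega
  obtain ⟨P, hPρ, hPξ, hP₁, hP₂⟩ := exists_perm_of_complementary hρmono hξmono hρran hξran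
  obtain ⟨Q, hQσ, hQη, hQ₁, hQ₂⟩ := exists_perm_of_complementary hσmono hηmono hσran hηran
  set E := upperToeplitz (m + d) (∏ i, (1 + PowerSeries.C (z i) * PowerSeries.X)) with hE
  set H := upperToeplitz (m + d) (∏ i, PowerSeries.mk fun r => (-z i) ^ r) with hH
  have hEH : E * H = 1 := by
    rw [hE, hH, upperToeplitz_mul, prod_one_add_mul_prod_geometric, upperToeplitz_one]
  have hdetE : E.det = 1 := by simp [hE, det_upperToeplitz]
  have hleft : (Matrix.of fun j k : Fin m =>
      eInt w z ((σ (k.1 + 1) : ℤ) - (ρ (j.1 + 1) : ℤ)))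
      = E.submatrix (P ∘ Fin.castAdd d) (Q ∘ Fin.castAdd d) := by
    ext j k
    rw [Matrix.of_apply, Matrix.submatrix_apply, hE, Function.comp_apply, Function.comp_apply,
      ← eInt_sub_eq_upperToeplitz, hPρ, hQσ]
    push_cast
    rw [add_sub_add_right_eq_sub]
  let K : Matrix (Fin d) (Fin d) ℂ := Matrix.of fun j k =>
    hInt w z (((P (Fin.natAdd m k)).1 : ℤ) - ((Q (Fin.natAdd m j)).1 : ℤ))
  have hright : skewSchur w z d
      (fun j => (ξ (d + 1 - j) : ℤ) - ((d + 1 - j : ℕ) : ℤ))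
      (fun k => (η (d + 1 - k) : ℤ) - ((d + 1 - k : ℕ) : ℤ)) = K.det := by
    rw [← Matrix.det_transpose K, ← Matrix.det_submatrix_equiv_self Fin.revPerm K.transpose]
    unfold skewSchur
    congr 1
    ext j k
    have hrev : ∀ i : Fin d, d + 1 - (i.1 + 1) = i.rev.1 + 1 := fun i => by
      rw [Fin.val_rev]
      omega
    have hj := hrev j
    have hk := hrev k
    simp only [Matrix.of_apply, Matrix.submatrix_apply, Matrix.transpose_apply, K,
      Fin.revPerm_apply]
    rw [hj, hk, hPξ, hQη]
    congr 1
    push_cast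
    omega
  have hHdet : (H.submatrix (Q ∘ Fin.natAdd m) (P ∘ Fin.natAdd m)).det
      = (∏ i : Fin d, (-1) ^ (Q (Fin.natAdd m i)).1) *
        ((∏ i : Fin d, (-1) ^ (P (Fin.natAdd m i)).1) * K.det) := by
    rw [← Matrix.det_mul_row, ← Matrix.det_mul_column]
    congr 1
    ext j k
    exact (neg_one_pow_mul_hInt_sub_eq_upperToeplitz w z _ _ _).symm
  have hsign : ∀ S : Equiv.Perm (Fin (m + d)), StrictMono (S ∘ Fin.castAdd d) →
      StrictMono (S ∘ Fin.natAdd m) →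
      ((Equiv.Perm.sign S : ℤ) : ℂ) * ∏ i : Fin d, (-1) ^ (S (Fin.natAdd m i)).1
        = (∏ i : Fin (m + d), (-1) ^ i.1) * ∏ i : Fin m, (-1) ^ i.1 := by
    intro S h₁ h₂
    rw [Equiv.Perm.sign_of_strictMono_castAdd_natAdd S h₁ h₂,
      ← Equiv.prod_comp S fun i : Fin (m + d) => (-1 : ℂ) ^ i.1, Fin.prod_univ_add]
    push_cast
    simp only [pow_add, Finset.prod_mul_distrib]
    ring
  have hsq : ∀ l : ℕ, (∏ i : Fin l, (-1 : ℂ) ^ i.1) * ∏ i : Fin l, (-1 : ℂ) ^ i.1 = 1 := by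
    intro l
    rw [← Finset.prod_mul_distrib]
    exact Finset.prod_eq_one fun i _ => by rw [← mul_pow]; simp
  rw [hleft, hright, Matrix.det_submatrix_perm_castAdd hEH, hdetE, hHdet]
  linear_combination
    (((Equiv.Perm.sign Q : ℤ) : ℂ) * (∏ i : Fin d, (-1) ^ (Q (Fin.natAdd m i)).1) * K.det) *
        hsign P hP₁ hP₂ +
      (∏ i : Fin (m + d), (-1 : ℂ) ^ i.1) * (∏ i : Fin m, (-1) ^ i.1) * K.det *
        hsign Q hQ₁ hQ₂ +
      K.det * (∏ i : Fin m, (-1 : ℂ) ^ i.1) * (∏ i : Fin m, (-1 : ℂ) ^ i.1) * hsq (m + d) +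
      K.det * hsq m
end

section
/- Let w ≥ 1 and x_1,…,x_w be variables (or complex numbers), let n, p ≥ 1 and r, s ∈ {1,…,n}. Then the skew Schur polynomial of the skew partition (n^p, s)/(r) satisfies s_{(n^p, s)/(r)} = Σ_{k = max(0, s−r)}^{min(n−r, s)} s_{(n^{p−1}, n+s−r−k, k)}, where (n^p, s) is the partition with n repeated p times followed by the part s, (r) is the single-part partition, and (n^{p−1}, n+s−r−k, k) is the partition with n repeated p−1 times, then the parts n+s−r−k and k. (If the lower summation limit exceeds the upper one the sum is empty and both sides are zero.) -/
open scoped BigOperators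

open PowerSeries in
/-- If all but the first two of the arguments `l i` are consecutive, lowering the first column of
`det [f (l i + k)]` by `r` amounts to lowering the first two rows by `r` in total. -/
theorem det_shift_first_col_eq_sum_antidiagonal {R : Type*} [CommRing R] (f : ℤ → R) (m r : ℕ)
    (l : Fin (m + 2) → ℤ) (hl : ∀ i : Fin m, l i.succ.succ = l i.succ.castSucc + 1) :
    (Matrix.of fun i k : Fin (m + 2) => if k = 0 then f (l i - r) else f (l i + k.1)).det =
      ∑ a ∈ Finset.HasAntidiagonal.antidiagonal r, (Matrix.of fun i k : Fin (m + 2) =>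
        f ((if i = 0 then l 0 - a.1 else if i = 1 then l 1 - a.2 else l i) + k.1)).det := by
  let H : ℤ → R⟦X⟧ := fun c => PowerSeries.mk fun i => f (c - i)
  have H_eq (c : ℤ) : H (c + 1) = C (f (c + 1)) + X * H c := by
    ext (_ | i)
    · simp [H]
    · simp [H, coeff_succ_X_mul, add_sub_add_right_eq_sub]
  let full : Matrix (Fin (m + 2)) (Fin (m + 2)) R⟦X⟧ := Matrix.of fun i k => H (l i + k.1)
  let colH : Matrix (Fin (m + 2)) (Fin (m + 2)) R⟦X⟧ :=
    Matrix.of fun i k => if k = 0 then H (l i) else C (f (l i + k.1))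
  let rowH : Matrix (Fin (m + 2)) (Fin (m + 2)) R⟦X⟧ :=
    Matrix.of fun i k => if i = 0 ∨ i = 1 then H (l i + k.1) else C (f (l i + k.1))
  have col_eq : full.det = colH.det := by
    refine Matrix.det_eq_of_forall_col_eq_smul_add_pred (fun _ => X) (fun i => ?_)
      (fun i k => ?_)
    · simp [full, colH]
    · simp [full, colH, ← add_assoc, H_eq]
  have row_eq : full.det = rowH.det := by
    refine Matrix.det_eq_of_forall_row_eq_smul_add_pred (fun i => if i = 0 then 0 else X)
      (fun k => ?_) (fun i k => ?_)
    · simp [full, rowH]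
    · refine Fin.cases ?_ (fun i => ?_) i
      · simp [full, rowH]
      · have h1 : (i.succ.succ : Fin (m + 2)) ≠ 1 := by simp [Fin.ext_iff]
        have h2 : l i.succ.succ + (k.1 : ℤ) = l i.succ.castSucc + k.1 + 1 := by
          rw [hl]; ring
        simp only [full, rowH, Matrix.of_apply, h1, Fin.succ_ne_zero, or_self, if_false, h2, H_eq]
  have key := congrArg (coeff r) (col_eq.symm.trans row_eq)
  rw [← Matrix.det_transpose rowH, Matrix.det_apply',
    Matrix.det_apply', map_sum, map_sum] at key
  convert key using 1
  · rw [Matrix.det_apply']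
    refine Finset.sum_congr rfl fun σ _ => ?_
    simp only [Fin.prod_univ_succ (n := m + 1), Matrix.of_apply, colH, Fin.succ_ne_zero, if_true,
      if_false, ← map_prod]
    rw [← map_intCast (C (R := R)), coeff_C_mul, coeff_mul_C, coeff_mk]
  · simp_rw [← Matrix.det_transpose (Matrix.of _), Matrix.det_apply']
    rw [Finset.sum_comm]
    refine Finset.sum_congr rfl fun σ _ => ?_
    have h1 (i : Fin m) : i.succ.succ ≠ 1 := by simp [Fin.ext_iff]
    simp only [Fin.prod_univ_succ, Matrix.transpose_apply, Matrix.of_apply, rowH, h1,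
      Fin.succ_ne_zero, Fin.succ_zero_eq_one, if_true, if_false, or_self, true_or, or_true,
      ← map_prod]
    rw [← map_intCast (C (R := R)), coeff_C_mul, ← mul_assoc (H _), coeff_mul_C, coeff_mul,
      ← Finset.mul_sum, Finset.sum_mul]
    simp only [H, coeff_mk, ← mul_assoc, sub_add_eq_add_sub]

theorem Matrix.det_eq_sign_rev_mul {R : Type*} [CommRing R] {m : ℕ} (M : Matrix (Fin m) (Fin m) R) :
    M.det = (Equiv.Perm.sign (Fin.revPerm : Equiv.Perm (Fin m)) : ℤ) *
      (M.submatrix Fin.revPerm id).det := by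
  rw [Matrix.det_permute, ← mul_assoc, ← Int.cast_mul, ← Units.val_mul, Int.units_mul_self]
  simp

/-- A sum over an integer interval of a function odd about its midpoint vanishes. -/
theorem sum_Icc_eq_zero_of_reflect {R : Type*} [AddCommGroup R] [IsAddTorsionFree R]
    (E : ℤ → R) (a b : ℤ) (hE : ∀ k, E (a + b - k) = -E k) : ∑ k ∈ Finset.Icc a b, E k = 0 := by
  refine self_eq_neg.1 ?_
  rw [← Finset.sum_neg_distrib]
  refine Finset.sum_nbij' (fun k => a + b - k) (fun k => a + b - k) ?_ ?_ ?_ ?_ ?_ <;>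
    simp +contextual [hE] <;> omega

theorem sum_Icc_eq_of_reflect {R : Type*} [AddCommGroup R] [IsAddTorsionFree R] (E : ℤ → R)
    (n r s : ℕ) (hs : s ≤ n) (hneg : ∀ k < 0, E k = 0)
    (hE : ∀ k, E (n + s - r + 1 - k) = -E k) :
    ∑ k ∈ Finset.Icc ((s : ℤ) - r) s, E k =
      ∑ k ∈ Finset.Icc (max 0 ((s : ℤ) - r)) (min ((n : ℤ) - r) s), E k := by
  have h0 : ∑ k ∈ Finset.Icc (n - r + 1 : ℤ) s, E k = 0 :=
    sum_Icc_eq_zero_of_reflect E _ _ fun k => by rw [← hE]; congr 1; ring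
  have h1 : Finset.Icc ((s : ℤ) - r) s = Finset.Icc ((s : ℤ) - r) (min ((n : ℤ) - r) s) ∪
      Finset.Icc (n - r + 1 : ℤ) s := by
    ext k; simp only [Finset.mem_union, Finset.mem_Icc]; omega
  rw [h1, Finset.sum_union, h0, add_zero]
  · symm
    refine Finset.sum_subset (Finset.Icc_subset_Icc (le_max_right _ _) le_rfl) fun k hk hk' => ?_
    apply hneg
    simp only [Finset.mem_Icc] at hk hk'; omega
  · rw [Finset.disjoint_left]; intro k; simp only [Finset.mem_Icc]; omega

/-- The determinant `det [f (a_i + k)]` with its rows listed from the bottom up, where the bottom two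
rows start at `a` and `b` and the others at `c + 2, c + 3, …`. -/
def stripDet {R : Type*} [CommRing R] (f : ℤ → R) (m : ℕ) (c a b : ℤ) : R :=
  (Matrix.of fun i k : Fin (m + 2) =>
    f ((if i = 0 then a else if i = 1 then b else c + i.1) + k.1)).det

theorem stripDet_swap {R : Type*} [CommRing R] (f : ℤ → R) (m : ℕ) (c a b : ℤ) :
    stripDet f m c b a = -stripDet f m c a b := by
  have h01 : (0 : Fin (m + 2)) ≠ 1 := by simp
  have h := Matrix.det_permute (Equiv.swap (0 : Fin (m + 2)) 1) (Matrix.of fun i k : Fin (m + 2) =>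
    f ((if i = 0 then a else if i = 1 then b else c + i.1) + k.1))
  rw [Equiv.Perm.sign_swap h01] at h
  simp only [Units.val_neg, Units.val_one, Int.cast_neg, Int.cast_one, neg_one_mul] at h
  rw [stripDet, stripDet, ← h]
  congr 1
  ext i k
  simp only [Matrix.of_apply, Matrix.submatrix_apply, id]
  by_cases hi0 : i = 0
  · simp [hi0]
  by_cases hi1 : i = 1
  · simp [hi1]
  simp [hi0, hi1, Equiv.swap_apply_of_ne_of_ne]

theorem stripDet_eq_zero {R : Type*} [CommRing R] (f : ℤ → R) (hf : ∀ x < 0, f x = 0) (m : ℕ)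
    (c a b : ℤ) (ha : a + m + 1 < 0) : stripDet f m c a b = 0 := by
  refine Matrix.det_eq_zero_of_row_eq_zero 0 fun k => ?_
  simp only [Matrix.of_apply, if_true]
  exact hf _ (by omega)

theorem hInt_of_neg (w : ℕ) (z : Fin w → ℂ) (x : ℤ) (hx : x < 0) : hInt w z x = 0 :=
  if_neg hx.not_ge

/-- Lemma 5 (skew Pieri special case, eq:LR_specialcase):
`s_{(n^p, s)/(r)} = Σ_{k = max(0,s-r)}^{min(n-r,s)} s_{(n^{p-1}, n+s-r-k, k)}`. -/
theorem skewSchur_rect_strip_expansion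
    (w : ℕ) (hw : 1 ≤ w) (z : Fin w → ℂ)
    (n p : ℕ) (hn : 1 ≤ n) (hp : 1 ≤ p)
    (r s : ℕ) (hr : 1 ≤ r) (hrn : r ≤ n) (hs : 1 ≤ s) (hsn : s ≤ n) :
    skewSchur w z (p + 1)
        (fun j => if j ≤ p then (n : ℤ) else (s : ℤ))
        (fun k => if k = 1 then (r : ℤ) else 0)
      = ∑ k ∈ Finset.Icc (max 0 ((s : ℤ) - (r : ℤ))) (min ((n : ℤ) - (r : ℤ)) (s : ℤ)),
          schur w z (p + 1)
            (fun j => if j ≤ p - 1 then (n : ℤ)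
              else if j = p then (n : ℤ) + (s : ℤ) - (r : ℤ) - k else k) := by
  obtain ⟨m, rfl⟩ : ∃ m, p = m + 1 := ⟨p - 1, by omega⟩
  let E : ℤ → ℂ := fun k =>
    stripDet (hInt w z) m ((n : ℤ) - m - 1) (k - m - 1) ((n : ℤ) + s - r - k - m)
  have hE : ∑ k ∈ Finset.Icc ((s : ℤ) - r) s, E k =
      ∑ k ∈ Finset.Icc (max 0 ((s : ℤ) - r)) (min ((n : ℤ) - r) s), E k := by
    refine sum_Icc_eq_of_reflect E n r s hsn
      (fun k hk => stripDet_eq_zero _ (hInt_of_neg w z) _ _ _ _ (by omega)) fun k => ?_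
    simp only [E]
    rw [← stripDet_swap]
    congr 1 <;> ring
  have hanti : ∑ a ∈ Finset.HasAntidiagonal.antidiagonal r, E (s - a.1) = ∑ k ∈ Finset.Icc ((s : ℤ) - r) s, E k := by
    refine Finset.sum_nbij' (fun a => (s : ℤ) - a.1)
      (fun k => ((s - k).toNat, (r - (s - k)).toNat)) ?_ ?_ ?_ ?_ ?_ <;>
      simp +contextual [Prod.ext_iff] <;> omega
  rw [skewSchur, Matrix.det_eq_sign_rev_mul]
  have hR (k : ℤ) : schur w z (m + 1 + 1)
      (fun j => if j ≤ m + 1 - 1 then (n : ℤ)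
        else if j = m + 1 then (n : ℤ) + (s : ℤ) - (r : ℤ) - k else k) =
      (Equiv.Perm.sign (Fin.revPerm : Equiv.Perm (Fin (m + 1 + 1))) : ℤ) * E k := by
    rw [schur, skewSchur, Matrix.det_eq_sign_rev_mul]
    simp only [E, stripDet]
    congr 2
    ext i j
    simp only [Matrix.submatrix_apply, Matrix.of_apply, Fin.revPerm_apply, Fin.val_rev, id, Fin.ext_iff,
      Fin.val_zero, Fin.val_one]
    congr 1
    split_ifs <;> omega
  rw [Finset.sum_congr rfl fun k _ => hR k, ← Finset.mul_sum, ← hE, ← hanti]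
  congr 1
  refine Eq.trans ?_ ((det_shift_first_col_eq_sum_antidiagonal (hInt w z) m r
    (fun i => if i = 0 then (s : ℤ) - m - 1 else (n : ℤ) - m - 1 + i.1) fun i => ?_).trans ?_)
  · congr 1
    ext i j
    simp only [Matrix.submatrix_apply, Matrix.of_apply, Fin.revPerm_apply, Fin.val_rev, id, Fin.ext_iff,
      Fin.val_zero]
    rw [← apply_ite (hInt w z)]
    congr 1
    split_ifs <;> omega
  · simp [Fin.ext_iff]; ring
  · refine Finset.sum_congr rfl fun a ha => ?_
    rw [Finset.HasAntidiagonal.mem_antidiagonal] at ha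
    simp only [E, stripDet]
    congr 2
    ext i j
    congr 2
    simp only [Fin.ext_iff, Fin.val_zero, Fin.val_one]
    simp only [if_true, one_ne_zero, if_false]
    split_ifs <;> omega
end
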